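/- arXiv:0908.2724 — 3 statements merged into one kernel-verified Lean document; each statement's English description precedes it below -/
import Mathlib

section
/- Forward direction of Theorem 1: let X be a real m × ℓ matrix and K a real ℓ × ℓ matrix. Suppose the pair (w*, e*) with X' w* ≠ 0 and K e* ≠ 0 maximises the quotient ρ(w, e) = ⟨X' w, K e⟩ / (‖X' w‖ · ‖K e‖) over all pairs (w, e) ∈ ℝ^m × ℝ^ℓ with X' w ≠ 0 and K e ≠ 0, and that the maximal value of ρ is positive. Then there exist reals μ > 0 and γ > 0 such that ‖K (γ e*)‖ = 1 and the pair (μ w*, γ e*) minimises ‖X' w − K e‖² over all pairs (w, e) ∈ ℝ^m × ℝ^ℓ satisfying ‖K e‖² = 1. -/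
open Matrix

/-- The CCA correlation quotient `ρ(w, e) = ⟨X' w, K e⟩ / (‖X' w‖ ‖K e‖)`,
written with Euclidean norms expressed via dot products. -/
noncomputable def ccaRho {m ℓ : ℕ} (X : Matrix (Fin m) (Fin ℓ) ℝ)
    (K : Matrix (Fin ℓ) (Fin ℓ) ℝ) (w : Fin m → ℝ) (e : Fin ℓ → ℝ) : ℝ :=
  (Xᵀ.mulVec w ⬝ᵥ K.mulVec e) /
    (Real.sqrt (Xᵀ.mulVec w ⬝ᵥ Xᵀ.mulVec w) * Real.sqrt (K.mulVec e ⬝ᵥ K.mulVec e))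

theorem sq_sqrt_dotProduct_self {n : Type*} [Fintype n] (x : n → ℝ) :
    √(x ⬝ᵥ x) ^ 2 = x ⬝ᵥ x :=
  Real.sq_sqrt (by simpa using dotProduct_self_star_nonneg x)

theorem sqrt_dotProduct_self_pos {n : Type*} [Fintype n] {x : n → ℝ} (hx : x ≠ 0) :
    0 < √(x ⬝ᵥ x) :=
  Real.sqrt_pos.2 (by simpa using dotProduct_self_star_pos_iff.2 hx)

/-- The squared Euclidean distance to a unit vector, bounded below when the inner product
is at most `r` times the norm. -/
theorem one_sub_sq_le_dotProduct_sub_self {n : Type*} [Fintype n] {x y : n → ℝ} {r : ℝ}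
    (hy : y ⬝ᵥ y = 1) (hxy : x ⬝ᵥ y ≤ r * √(x ⬝ᵥ x)) :
    1 - r ^ 2 ≤ (x - y) ⬝ᵥ (x - y) := by
  have hs : √(x ⬝ᵥ x) ^ 2 = x ⬝ᵥ x := sq_sqrt_dotProduct_self x
  simp only [sub_dotProduct, dotProduct_sub, dotProduct_comm y x, hy]
  nlinarith [sq_nonneg (√(x ⬝ᵥ x) - r)]

/-- Forward direction of Theorem 1: if `(w*, e*)` maximises the correlation quotient
(with a positive maximal value), then suitable positive rescalings `(μ w*, γ e*)`
minimise `‖X' w − K e‖²` subject to `‖K e‖² = 1`, with `‖K (γ e*)‖ = 1`. -/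
theorem cca_max_implies_ls_min {m ℓ : ℕ}
    (X : Matrix (Fin m) (Fin ℓ) ℝ) (K : Matrix (Fin ℓ) (Fin ℓ) ℝ)
    (wstar : Fin m → ℝ) (estar : Fin ℓ → ℝ)
    (hw : Xᵀ.mulVec wstar ≠ 0) (he : K.mulVec estar ≠ 0)
    (hmax : ∀ (w : Fin m → ℝ) (e : Fin ℓ → ℝ),
      Xᵀ.mulVec w ≠ 0 → K.mulVec e ≠ 0 → ccaRho X K w e ≤ ccaRho X K wstar estar)
    (hpos : 0 < ccaRho X K wstar estar) :
    ∃ μ : ℝ, 0 < μ ∧ ∃ γ : ℝ, 0 < γ ∧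
      Real.sqrt (K.mulVec (γ • estar) ⬝ᵥ K.mulVec (γ • estar)) = 1 ∧
      ∀ (w : Fin m → ℝ) (e : Fin ℓ → ℝ), K.mulVec e ⬝ᵥ K.mulVec e = 1 →
        (Xᵀ.mulVec (μ • wstar) - K.mulVec (γ • estar)) ⬝ᵥ
            (Xᵀ.mulVec (μ • wstar) - K.mulVec (γ • estar)) ≤
          (Xᵀ.mulVec w - K.mulVec e) ⬝ᵥ (Xᵀ.mulVec w - K.mulVec e) := by
  have hA : 0 < √((Xᵀ *ᵥ wstar) ⬝ᵥ (Xᵀ *ᵥ wstar)) := sqrt_dotProduct_self_pos hw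
  have hB : 0 < √((K *ᵥ estar) ⬝ᵥ (K *ᵥ estar)) := sqrt_dotProduct_self_pos he
  have hA2 := sq_sqrt_dotProduct_self (Xᵀ *ᵥ wstar)
  have hB2 := sq_sqrt_dotProduct_self (K *ᵥ estar)
  have hc : (Xᵀ *ᵥ wstar) ⬝ᵥ (K *ᵥ estar) = ccaRho X K wstar estar *
      (√((Xᵀ *ᵥ wstar) ⬝ᵥ (Xᵀ *ᵥ wstar)) * √((K *ᵥ estar) ⬝ᵥ (K *ᵥ estar))) := by
    rw [ccaRho, div_mul_cancel₀ _ (mul_pos hA hB).ne']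
  set r := ccaRho X K wstar estar
  set A := √((Xᵀ *ᵥ wstar) ⬝ᵥ (Xᵀ *ᵥ wstar))
  set B := √((K *ᵥ estar) ⬝ᵥ (K *ᵥ estar))
  refine ⟨r / A, div_pos hpos hA, B⁻¹, inv_pos.2 hB, ?_, fun w e hy => ?_⟩
  · simp only [mulVec_smul, smul_dotProduct, dotProduct_smul, smul_eq_mul, ← hB2]
    field_simp
    simp
  · have hxy : (Xᵀ *ᵥ w) ⬝ᵥ (K *ᵥ e) ≤ r * √((Xᵀ *ᵥ w) ⬝ᵥ (Xᵀ *ᵥ w)) := by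
      by_cases hx : Xᵀ *ᵥ w = 0
      · simp [hx]
      · have hs : 0 < √((Xᵀ *ᵥ w) ⬝ᵥ (Xᵀ *ᵥ w)) := sqrt_dotProduct_self_pos hx
        have hρ := hmax w e hx (dotProduct_self_eq_zero.not.1 (by simp [hy]))
        rwa [ccaRho, hy, Real.sqrt_one, mul_one, div_le_iff₀ hs] at hρ
    refine le_trans (le_of_eq ?_) (one_sub_sq_le_dotProduct_sub_self hy hxy)
    simp only [mulVec_smul, sub_dotProduct, dotProduct_sub, smul_dotProduct, dotProduct_smul,
      smul_eq_mul, dotProduct_comm (K *ᵥ estar) (Xᵀ *ᵥ wstar), ← hA2, ← hB2, hc]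
    field_simp
    ring
end

section
/- Converse direction of Theorem 1: let X be a real m × ℓ matrix and K a real ℓ × ℓ matrix. Suppose the pair (w*, e*) minimises ‖X' w − K e‖² over all pairs (w, e) ∈ ℝ^m × ℝ^ℓ satisfying ‖K e‖² = 1, and that X' w* ≠ 0. Then (w*, e*) maximises the quotient ρ(w, e) = ⟨X' w, K e⟩ / (‖X' w‖ · ‖K e‖) over all pairs (w, e) with X' w ≠ 0 and K e ≠ 0. -/
open Matrix

/-- Expansion of the squared Euclidean distance between scalar multiples of two vectors. -/
lemma smul_sub_smul_dotProduct_self {n : Type*} [Fintype n] (s t : ℝ) (x y : n → ℝ) :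
    (s • x - t • y) ⬝ᵥ (s • x - t • y) =
      s ^ 2 * (x ⬝ᵥ x) - 2 * s * t * (x ⬝ᵥ y) + t ^ 2 * (y ⬝ᵥ y) := by
  simp only [sub_dotProduct, dotProduct_sub, smul_dotProduct, dotProduct_smul, smul_eq_mul,
    dotProduct_comm y x]
  ring

lemma dotProduct_self_pos_of_ne_zero {n : Type*} [Fintype n] {x : n → ℝ} (hx : x ≠ 0) :
    0 < x ⬝ᵥ x :=
  (Finset.sum_nonneg fun i _ => mul_self_nonneg (x i)).lt_of_ne'
    (mt dotProduct_self_eq_zero.mp hx)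

/-- Converse direction of Theorem 1: if `(w*, e*)` minimises `‖X' w − K e‖²` subject to
`‖K e‖² = 1`, and `X' w* ≠ 0`, then `(w*, e*)` maximises the correlation quotient. -/
theorem ls_min_implies_cca_max {m ℓ : ℕ}
    (X : Matrix (Fin m) (Fin ℓ) ℝ) (K : Matrix (Fin ℓ) (Fin ℓ) ℝ)
    (wstar : Fin m → ℝ) (estar : Fin ℓ → ℝ)
    (hcon : K.mulVec estar ⬝ᵥ K.mulVec estar = 1)
    (hmin : ∀ (w : Fin m → ℝ) (e : Fin ℓ → ℝ), K.mulVec e ⬝ᵥ K.mulVec e = 1 →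
      (Xᵀ.mulVec wstar - K.mulVec estar) ⬝ᵥ (Xᵀ.mulVec wstar - K.mulVec estar) ≤
        (Xᵀ.mulVec w - K.mulVec e) ⬝ᵥ (Xᵀ.mulVec w - K.mulVec e))
    (hw : Xᵀ.mulVec wstar ≠ 0) :
    ∀ (w : Fin m → ℝ) (e : Fin ℓ → ℝ),
      Xᵀ.mulVec w ≠ 0 → K.mulVec e ≠ 0 → ccaRho X K w e ≤ ccaRho X K wstar estar := by
  intro w e hXw hKe
  have hmin_smul (s t : ℝ) (w : Fin m → ℝ) (e : Fin ℓ → ℝ)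
      (ht : t ^ 2 * (K.mulVec e ⬝ᵥ K.mulVec e) = 1) :
      Xᵀ.mulVec wstar ⬝ᵥ Xᵀ.mulVec wstar - 2 * (Xᵀ.mulVec wstar ⬝ᵥ K.mulVec estar) ≤
        s ^ 2 * (Xᵀ.mulVec w ⬝ᵥ Xᵀ.mulVec w) - 2 * s * t * (Xᵀ.mulVec w ⬝ᵥ K.mulVec e) := by
    have h := hmin (s • w) (t • e) (by
      simp only [mulVec_smul, smul_dotProduct, dotProduct_smul, smul_eq_mul]
      linarith)
    have h₁ := smul_sub_smul_dotProduct_self 1 1 (Xᵀ.mulVec wstar) (K.mulVec estar)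
    simp only [one_smul] at h₁
    rw [mulVec_smul, mulVec_smul, smul_sub_smul_dotProduct_self, h₁, ht, hcon] at h
    linarith
  have hA := dotProduct_self_pos_of_ne_zero hw
  have hW := dotProduct_self_pos_of_ne_zero hXw
  have hE := dotProduct_self_pos_of_ne_zero hKe
  have hscale := fun s => hmin_smul s 1 wstar estar (by rw [hcon]; norm_num)
  have hbound := fun s t => hmin_smul s t w e
  unfold ccaRho
  rw [hcon]
  generalize Xᵀ.mulVec wstar ⬝ᵥ Xᵀ.mulVec wstar = A at *
  generalize Xᵀ.mulVec wstar ⬝ᵥ K.mulVec estar = P at *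
  generalize Xᵀ.mulVec w ⬝ᵥ Xᵀ.mulVec w = W at *
  generalize K.mulVec e ⬝ᵥ K.mulVec e = E at *
  generalize Xᵀ.mulVec w ⬝ᵥ K.mulVec e = C at *
  have hPA : P = A := by
    have h := hscale (P / A)
    have h₁ : (P / A) ^ 2 * A - 2 * (P / A) * 1 * P = -(P ^ 2 / A) := by field_simp; ring
    have h₂ : P ^ 2 / A * A = P ^ 2 := by field_simp
    rw [h₁] at h
    have h₃ := mul_le_mul_of_nonneg_right h hA.le
    have h₄ : (P - A) ^ 2 = 0 := le_antisymm (by nlinarith) (sq_nonneg _)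
    exact sub_eq_zero.mp (pow_eq_zero_iff two_ne_zero |>.mp h₄)
  have hsq : (C / (√W * √E)) ^ 2 ≤ A := by
    have hE' : 0 < √E := Real.sqrt_pos.mpr hE
    have h := hbound (C / (W * √E)) (1 / √E) (by
      rw [div_pow, Real.sq_sqrt hE.le]; field_simp)
    have h₁ : (C / (W * √E)) ^ 2 * W - 2 * (C / (W * √E)) * (1 / √E) * C =
        -(C / (√W * √E)) ^ 2 := by
      rw [div_pow, div_pow, mul_pow, mul_pow, Real.sq_sqrt hW.le]
      field_simp
      ring
    rw [h₁, hPA] at h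
    linarith
  rw [hPA, Real.sqrt_one, mul_one, Real.div_sqrt]
  exact Real.le_sqrt_of_sq_le hsq
end

section
/- Exact coordinate update for the dual variables: let X be a real m × ℓ matrix, K a real symmetric ℓ × ℓ matrix, w ∈ ℝ^m, and c ∈ ℝ^ℓ, and define L : ℝ^ℓ → ℝ by L(e) = e' K² e − 2 w' X K e + c' e. Fix an index i with (K²)_{ii} > 0. Then the function t ↦ L(e + t i_i) is uniquely minimised at t* = (1 / (2 (K²)_{ii})) · (2 K X' w − 2 K² e − c)_i. -/
open Matrix

/-- A symmetric quadratic form along the `i`-th coordinate line is a quadratic polynomial. -/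
theorem Matrix.IsSymm.dotProduct_mulVec_add_smul_single {n R : Type*} [Fintype n] [DecidableEq n]
    [CommRing R] {A : Matrix n n R} (hA : A.IsSymm) (e : n → R) (i : n) (t : R) :
    (e + t • Pi.single i 1) ⬝ᵥ A *ᵥ (e + t • Pi.single i 1) =
      e ⬝ᵥ A *ᵥ e + 2 * t * (A *ᵥ e) i + t ^ 2 * A i i := by
  have h : e ⬝ᵥ A.col i = (A *ᵥ e) i := by
    rw [dotProduct_comm]
    exact congrArg (· ⬝ᵥ e) (funext fun j => hA.apply i j)
  simp only [mulVec_add, mulVec_smul, mulVec_single_one, add_dotProduct, dotProduct_add,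
    smul_dotProduct, dotProduct_smul, single_one_dotProduct, smul_eq_mul, h, col_apply]
  ring

/-- Exact coordinate update for the dual variables: the function
`t ↦ L(e + t i_i)` with `L(e) = e' K² e − 2 w' X K e + c' e` is uniquely minimised at
`t* = (1 / (2 (K²)_{ii})) (2 K X' w − 2 K² e − c)_i`, provided `(K²)_{ii} > 0`. -/
theorem dual_coordinate_update {m ℓ : ℕ}
    (X : Matrix (Fin m) (Fin ℓ) ℝ) (K : Matrix (Fin ℓ) (Fin ℓ) ℝ) (hK : K.IsSymm)
    (w : Fin m → ℝ) (c : Fin ℓ → ℝ) (e : Fin ℓ → ℝ) (i : Fin ℓ)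
    (hdiag : 0 < (K * K) i i) :
    let L : (Fin ℓ → ℝ) → ℝ := fun v =>
      v ⬝ᵥ (K * K).mulVec v - 2 * (w ⬝ᵥ (X * K).mulVec v) + c ⬝ᵥ v
    let tstar : ℝ := (1 / (2 * (K * K) i i)) *
      (((2 : ℝ) • (K * Xᵀ).mulVec w - (2 : ℝ) • (K * K).mulVec e - c) i)
    (∀ t : ℝ, L (e + tstar • (Pi.single i 1 : Fin ℓ → ℝ)) ≤ L (e + t • (Pi.single i 1 : Fin ℓ → ℝ))) ∧
    (∀ t : ℝ, L (e + t • (Pi.single i 1 : Fin ℓ → ℝ)) = L (e + tstar • (Pi.single i 1 : Fin ℓ → ℝ)) → t = tstar) := by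
  intro L tstar
  set a := (K * K) i i with ha
  set b := ((2 : ℝ) • (K * Xᵀ).mulVec w - (2 : ℝ) • (K * K).mulVec e - c) i with hb
  have hKK : (K * K).IsSymm := by
    rw [Matrix.IsSymm, transpose_mul, hK.eq]
  have hlin : w ⬝ᵥ (X * K).col i = ((K * Xᵀ) *ᵥ w) i := by
    have hT : K * Xᵀ = (X * K)ᵀ := by rw [transpose_mul, hK.eq]
    rw [hT, dotProduct_comm]
    rfl
  have hL (t : ℝ) : L (e + t • Pi.single i 1) = L e + a * t ^ 2 - b * t := by
    simp only [L]
    rw [hKK.dotProduct_mulVec_add_smul_single]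
    simp only [hb, ha, mulVec_add, mulVec_smul, mulVec_single_one, dotProduct_add,
      dotProduct_smul, dotProduct_single_one, smul_eq_mul, hlin, Pi.sub_apply, Pi.smul_apply]
    ring
  have hbt : b = 2 * a * tstar := by
    have ht : tstar = 1 / (2 * a) * b := rfl
    rw [ht]
    field_simp
  have hsq (t : ℝ) : L (e + t • Pi.single i 1) =
      L (e + tstar • Pi.single i 1) + a * (t - tstar) ^ 2 := by
    rw [hL, hL, hbt]
    ring
  refine ⟨fun t => ?_, fun t ht => ?_⟩
  · rw [hsq t]
    exact le_add_of_nonneg_right (by positivity)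
  · rw [hsq t, add_eq_left] at ht
    simpa [hdiag.ne', sub_eq_zero] using ht
end
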